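/- Let K = ℚ(√13) be the real quadratic field generated by a root of x² − 13, and let P(X) = (X² + 5X + 13)·(X⁴ + 7X³ + 20X² + 19X + 1)³ ∈ K[X]. Then the Galois group over K of the polynomial F(X) = P(X) − (11225615440/1594323)·X (the Galois group of its splitting field over K) is isomorphic to the alternating group A₄. -/

import Mathlib

open Polynomial IntermediateField

/-- The real quadratic field `K = ℚ(√13)`, generated over `ℚ` by the root `√13 ∈ ℝ`
of `x² − 13`. -/
noncomputable def K13 : IntermediateField ℚ ℝ := ℚ⟮Real.sqrt 13⟯

/-- The polynomial `P(X) = (X² + 5X + 13)·(X⁴ + 7X³ + 20X² + 19X + 1)³` over `K = ℚ(√13)`. -/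
noncomputable def P13 : Polynomial K13 :=
  (X ^ 2 + 5 * X + 13) * (X ^ 4 + 7 * X ^ 3 + 20 * X ^ 2 + 19 * X + 1) ^ 3

/-- `F(X) = P(X) − (11225615440/1594323)·X` over `K = ℚ(√13)`. -/
noncomputable def F15 : Polynomial K13 := P13 - C (11225615440 / 1594323 : K13) * X

section Identities

variable {R : Type*} [Field R]

/-- With `s² = 13`, this sends a root of `X⁴ + 234X² + 728X + 637` to a root of a quartic
factor of `F`. -/
def octicRoot (a s : R) : R :=
  -a ^ 3 / 480 - a ^ 2 / 480 - 47 * a / 96 - 1763 / 480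
    + (-69 * a ^ 3 / 14560 + a ^ 2 / 160 - 247 * a / 224 - 791 / 480) * s

/-- The inverse of `octicRoot` on roots. -/
def octicInv (x s : R) : R :=
  -3996 * x ^ 3 / 2941 - 95661 * x ^ 2 / 5882 - 180945 * x / 2941 - 557011 / 5882
    + (40095 * x ^ 3 / 38233 + 653481 * x ^ 2 / 76466 + 1092852 * x / 38233 + 2393909 / 76466) * s

/-- A quartic factor of `F` over any field containing `s = √13`. -/
def octicFactor (x s : R) : R :=
  x ^ 4 + 55 * x ^ 3 / 6 + 79 * x ^ 2 / 2 + 155 * x / 2 + 11251 / 162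
    + (-5 * x ^ 3 / 6 - 35 * x ^ 2 / 6 - 971 * x / 54 - 2875 / 162) * s

/-- The sextic factor of `F`. -/
def sexticFactor (x : R) : R :=
  x ^ 6 + 23 * x ^ 5 / 3 + 274 * x ^ 4 / 9 + 1523 * x ^ 3 / 27 + 4058 * x ^ 2 / 81
    - 2113 * x / 243 + 13 / 729

/-- A root of the resolvent `X³ + 117X² + 3263X - 8281` in terms of a root of the sextic factor. -/
def sexticToResolvent (x : R) : R :=
  -89181 * x ^ 5 / 99994 - 1201959 * x ^ 4 / 199988 - 1057131 * x ^ 3 / 49997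
    - 5086989 * x ^ 2 / 199988 + 211155 * x / 49997 + 465829 / 199988

variable [CharZero R]

theorem octicRoot_spec {a s : R} (ha : a ^ 4 + 234 * a ^ 2 + 728 * a + 637 = 0)
    (hs : s ^ 2 = 13) :
    octicFactor (octicRoot a s) s = 0 ∧ octicInv (octicRoot a s) s = a := by
  obtain ⟨x, hx⟩ : ∃ x, x = octicRoot a s := ⟨_, rfl⟩
  rw [← hx]
  unfold octicRoot at hx
  have h2 : x ^ 2 = 3571 * a ^ 3 * s / 131040 + 37 * a ^ 3 / 10080 - 59 * a ^ 2 * s / 1440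
    - a ^ 2 / 160 + 12857 * a * s / 2016 + 2083 * a / 2016 + 13223 * s / 1440 + 6893 / 1440 := by
    rw [hx]
    linear_combination (23 * a ^ 2 * s / 1164800 + 21743 * a ^ 2 / 73382400
      - 11 * a * s / 1747200 - 307 * a / 403200 + 16033 * s / 3494400 + 129989 / 1881600) * ha
      + (4761 * a ^ 6 / 211993600 - 69 * a ^ 5 / 1164800 + 13159 * a ^ 4 / 1254400
      + 1069 * a ^ 3 / 582400 + 4498157 * a ^ 2 / 3763200 + 27911 * a / 7680 + 625681 / 230400) * hs
  have h3 : x ^ 3 = -3041 * a ^ 3 * s / 32760 + 43 * a ^ 3 / 840 + 3 * a ^ 2 * s / 20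
    + a ^ 2 / 30 - 10949 * a * s / 504 + 16615 * a / 1512 - 8111 * s / 270 + 20549 / 540 := by
    rw [pow_succ x 2, h2, hx]
    linear_combination (-157 * a ^ 2 * s / 2116800 - 185641 * a ^ 2 / 110073600
      + 319 * a * s / 3931200 + 2869 * a / 604800 - 27779 * s / 1528800
      - 1118123 / 2822400) * ha + (-82133 * a ^ 6 / 635980800 + 3821 * a ^ 5 / 10483200
      - 683341 * a ^ 4 / 11289600 - 53243 * a ^ 3 / 15724800 - 233945363 * a ^ 2 / 33868800
      - 285259 * a / 13824 - 10459393 / 691200) * hs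
  have h4 : x ^ 4 = 28367 * a ^ 3 * s / 168480 - 15109 * a ^ 3 / 30240
    - 3721 * a ^ 2 * s / 12960 + 353 * a ^ 2 / 4320 + 101261 * a * s / 2592
    - 2051753 * a / 18144 + 670157 * s / 12960 - 4367663 / 12960 := by
    rw [pow_mul x 2 2, h2]
    linear_combination (132127 * a ^ 2 * s / 660441600 + 6384919 * a ^ 2 / 660441600
      - 30259 * a * s / 47174400 - 15073 * a / 518400 + 12511193 * s / 220147200
      + 116129231 / 50803200) * ha + (12752041 * a ^ 6 / 17171481600
      - 210689 * a ^ 5 / 94348800 + 11829253 * a ^ 4 / 33868800 - 38653 * a ^ 3 / 1747200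
      + 4056105839 * a ^ 2 / 101606400 + 24286873 * a / 207360 + 174847729 / 2073600) * hs
  refine ⟨?_, ?_⟩
  · unfold octicFactor
    rw [h4, h3, h2, hx]
    linear_combination (109 * a ^ 3 / 30240 + 7 * a ^ 2 / 4320 + 4411 * a / 6048
      + 14263 / 12960) * hs
  · unfold octicInv
    rw [h3, h2, hx]
    linear_combination (7071 * a ^ 3 / 85641920 - 13359 * a ^ 2 / 941120
      + 3442665 * a / 17128384 - 1623201 / 12234560) * hs

theorem sexticToResolvent_spec {x : R} (hx : sexticFactor x = 0) :
    sexticToResolvent x ^ 3 + 117 * sexticToResolvent x ^ 2 + 3263 * sexticToResolvent x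
      - 8281 = 0 ∧
      (x - (1 / 10 - sexticToResolvent x / 105 - sexticToResolvent x ^ 2 / 1365)) ^ 2 =
        13 * (17 / 1820 + 2 * sexticToResolvent x / 1365 + sexticToResolvent x ^ 2 / 23660) ^ 2 *
          sexticToResolvent x := by
  obtain ⟨v, hv⟩ : ∃ v, v = sexticToResolvent x := ⟨_, rfl⟩
  rw [← hv]
  unfold sexticToResolvent at hv
  unfold sexticFactor at hx
  have h2 : v ^ 2 = 4442283 * x ^ 5 / 99994 + 14871438 * x ^ 4 / 49997
    + 106989201 * x ^ 3 / 99994 + 64732203 * x ^ 2 / 49997 - 21479535 * x / 99994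
    + 295295 / 49997 := by
    rw [hv]
    linear_combination (7953250761 * x ^ 4 / 9998800036 + 23108491539 * x ^ 3 / 4999400018
      + 567271414881 * x ^ 2 / 39995200144 + 207904655259 * x / 39995200144
      - 1078088300667 / 39995200144) * hx
  have h3 : v ^ 3 = -114374754 * x ^ 5 / 49997 - 3037840767 * x ^ 4 / 199988
    - 5618899611 * x ^ 3 / 99994 - 13695825897 * x ^ 2 / 199988 + 1135108065 * x / 99994
    - 2097459 / 199988 := by
    rw [pow_succ v 2, h2, hv]
    linear_combination (-396167240223 * x ^ 4 / 9998800036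
      - 4569876531423 * x ^ 3 / 19997600072 - 14458922497539 * x ^ 2 / 19997600072
      - 5381848010511 * x / 19997600072 + 6797185686837 / 4999400018) * hx
  have hr : v ^ 3 + 117 * v ^ 2 + 3263 * v - 8281 = 0 := by
    rw [h3, h2, hv]
    ring
  refine ⟨hr, ?_⟩
  have h4 : x * v = 165483 * x ^ 5 / 199988 + 300402 * x ^ 4 / 49997 + 4973949 * x ^ 3 / 199988
    + 2445084 * x ^ 2 / 49997 - 1085113 * x / 199988 + 4771 / 299982 := by
    rw [hv]
    linear_combination (-89181 / 99994) * hx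
  have h5 : x * v ^ 2 = -4314627 * x ^ 5 / 99994 - 28253637 * x ^ 4 / 99994
    - 121113261 * x ^ 3 / 99994 - 244032429 * x ^ 2 / 99994 + 39218343 * x / 99994
    - 237653 / 299982 := by
    rw [h2]
    linear_combination (4442283 / 99994) * hx
  linear_combination (-(v ^ 2 / 43061200 - v / 608400 + 1049 / 7452900)) * hr + 2 / 105 * h4
    + 2 / 1365 * h5 + 43 / 4095 * h2 + 148 / 315 * hv

theorem octic_sextic_factorization {x s : R} (hs : s ^ 2 = 13) :
    (x ^ 2 + 5 * x + 13) * (x ^ 4 + 7 * x ^ 3 + 20 * x ^ 2 + 19 * x + 1) ^ 3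
        - 11225615440 / 1594323 * x =
      sexticFactor x * octicFactor x s * octicFactor x (-s) := by
  unfold sexticFactor octicFactor
  linear_combination (25 * x ^ 12 / 36 + 1625 * x ^ 11 / 108 + 17245 * x ^ 10 / 108
    + 258835 * x ^ 9 / 243 + 14279761 * x ^ 8 / 2916 + 140691163 * x ^ 7 / 8748
    + 498355897 * x ^ 6 / 13122 + 4975712843 * x ^ 5 / 78732 + 5517598751 * x ^ 4 / 78732
    + 7995113293 * x ^ 3 / 177147 + 21764604683 * x ^ 2 / 2125764 - 1932520375 * x / 708588
    + 107453125 / 19131876) * hs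

end Identities

section Quartic

/-- A quartic whose splitting field over `ℚ(√13)` is that of `F`. -/
noncomputable def quartic (R : Type*) [CommRing R] : R[X] :=
  X ^ 4 + 234 * X ^ 2 + 728 * X + 637

theorem quartic_map {R S : Type*} [CommRing R] [CommRing S] (f : R →+* S) :
    (quartic R).map f = quartic S := by
  simp [quartic]

theorem eval_quartic {R : Type*} [CommRing R] (x : R) :
    (quartic R).eval x = x ^ 4 + 234 * x ^ 2 + 728 * x + 637 := by
  simp [quartic]

theorem quartic_eq_C (R : Type*) [CommRing R] :
    quartic R = X ^ 4 + C 234 * X ^ 2 + C 728 * X + C 637 := by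
  simp only [quartic, map_ofNat]

theorem quartic_monic (R : Type*) [CommRing R] : (quartic R).Monic := by
  rw [quartic_eq_C]
  monicity!

theorem quartic_natDegree (R : Type*) [CommRing R] [Nontrivial R] :
    (quartic R).natDegree = 4 := by
  rw [quartic_eq_C]
  compute_degree!

theorem quartic_irreducible : Irreducible (quartic ℚ) := by
  have hmonic := quartic_monic ℤ
  have hdeg : (quartic ℤ).degree = 4 := by
    rw [degree_eq_natDegree hmonic.ne_zero, quartic_natDegree]
    rfl
  have hprime : (Ideal.span {(13 : ℤ)}).IsPrime :=
    (Ideal.span_singleton_prime (by norm_num)).2 (by norm_num)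
  have h : Irreducible (quartic ℤ) := by
    refine irreducible_of_eisenstein_criterion hprime ?_ ?_ (by rw [hdeg]; norm_num) ?_
      hmonic.isPrimitive
    · rw [hmonic.leadingCoeff, Ideal.mem_span_singleton]
      norm_num
    · intro n hn
      rw [hdeg] at hn
      have hn : n < 4 := by exact_mod_cast hn
      rw [Ideal.mem_span_singleton, quartic_eq_C]
      interval_cases n <;> simp [coeff_X, coeff_X_pow]
    · rw [Ideal.span_singleton_pow, Ideal.mem_span_singleton, quartic_eq_C]
      simp
  rw [hmonic.irreducible_iff_irreducible_map_fraction_map (K := ℚ), quartic_map] at h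
  exact h

theorem quartic_separable (K : Type*) [Field K] [Algebra ℚ K] : (quartic K).Separable := by
  rw [← quartic_map (algebraMap ℚ K)]
  exact quartic_irreducible.separable.map

/-- The resolvent cubic of `quartic`, with roots `((aᵢ + aⱼ) / 2)²`. -/
noncomputable def resolventCubic : ℚ[X] := X ^ 3 + C 117 * X ^ 2 + C 3263 * X - C 8281

theorem resolventCubic_natDegree : resolventCubic.natDegree = 3 := by
  unfold resolventCubic
  compute_degree!

theorem resolventCubic_irreducible : Irreducible resolventCubic := by
  refine irreducible_of_degree_le_three_of_not_isRoot (by simp [resolventCubic_natDegree]) ?_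
  intro x hx
  have hmonic : (X ^ 3 + C 117 * X ^ 2 + C 3263 * X - C 8281 : ℤ[X]).Monic := by monicity!
  have hx0 : x ^ 3 + 117 * x ^ 2 + 3263 * x - 8281 = 0 := by
    simpa [resolventCubic, IsRoot] using hx
  obtain ⟨n, rfl⟩ := isInteger_of_is_root_of_monic (A := ℤ) (K := ℚ) hmonic (r := x) (by
    simp only [map_sub, map_add, map_mul, map_pow, aeval_X, map_ofNat, hx0])
  have h : n ^ 3 + 117 * n ^ 2 + 3263 * n - 8281 = 0 := by
    simp only [eq_intCast] at hx0
    exact_mod_cast hx0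
  have h3 := congrArg (Int.cast : ℤ → ZMod 3) h
  push_cast at h3
  generalize (n : ZMod 3) = m at h3
  revert m
  decide

variable {M : Type*} [Field M] [CharZero M]

theorem quartic_vieta {a : Fin 4 → M} (hinj : Function.Injective a)
    (ha : ∀ i, (quartic M).IsRoot (a i)) :
    a 0 + a 1 + a 2 + a 3 = 0 ∧
      a 0 * a 1 + a 0 * a 2 + a 0 * a 3 + a 1 * a 2 + a 1 * a 3 + a 2 * a 3 = 234 ∧
      a 0 * a 1 * a 2 + a 0 * a 1 * a 3 + a 0 * a 2 * a 3 + a 1 * a 2 * a 3 = -728 ∧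
      a 0 * a 1 * a 2 * a 3 = 637 := by
  have hprod : (∏ i, (X - C (a i))).Monic := monic_prod_of_monic _ _ fun i _ => monic_X_sub_C _
  have hdeg : (quartic M).degree = 4 := by
    rw [degree_eq_natDegree (quartic_monic M).ne_zero, quartic_natDegree]
    rfl
  have hpoly : quartic M = ∏ i, (X - C (a i)) := by
    refine eq_of_degree_sub_lt_of_eval_index_eq Finset.univ hinj.injOn ?_ ?_
    · refine (degree_sub_lt_left ?_ (quartic_monic M).ne_zero ?_).trans_eq (by simpa using hdeg)
      · rw [degree_prod]
        simpa using hdeg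
      · rw [(quartic_monic M).leadingCoeff, hprod.leadingCoeff]
    · intro i _
      rw [(ha i).eq_zero, eval_prod, Finset.prod_eq_zero (Finset.mem_univ i)]
      simp
  have heval (x : M) : x ^ 4 + 234 * x ^ 2 + 728 * x + 637 =
      (x - a 0) * (x - a 1) * (x - a 2) * (x - a 3) := by
    rw [← eval_quartic, hpoly, eval_prod]
    simp [Fin.prod_univ_four]
  have h0 := heval 0
  have h1 := heval 1
  have h2 := heval (-1)
  have h3 := heval 2
  refine ⟨?_, ?_, ?_, ?_⟩
  · linear_combination (1 / 2) * h0 - (1 / 2) * h1 - (1 / 6) * h2 + (1 / 6) * h3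
  · linear_combination h0 - (1 / 2) * h1 - (1 / 2) * h2
  · linear_combination (-1 / 2) * h0 + h1 - (1 / 3) * h2 - (1 / 6) * h3
  · linear_combination -h0

theorem resolventCubic_factor {a : Fin 4 → M} (hinj : Function.Injective a)
    (ha : ∀ i, (quartic M).IsRoot (a i)) (v : M) :
    v ^ 3 + 117 * v ^ 2 + 3263 * v - 8281 =
      (v - ((a 0 + a 1) / 2) ^ 2) * (v - ((a 0 + a 2) / 2) ^ 2) * (v - ((a 0 + a 3) / 2) ^ 2) := by
  obtain ⟨h1, h2, h3, h4⟩ := quartic_vieta hinj ha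
  have h0 : a 3 = -(a 0 + a 1 + a 2) := by linear_combination h1
  rw [h0] at h2 h3 h4 ⊢
  obtain ⟨p, hp⟩ : ∃ p : M, p = 234 := ⟨_, rfl⟩
  obtain ⟨q, hq⟩ : ∃ q : M, q = 728 := ⟨_, rfl⟩
  obtain ⟨r, hr⟩ : ∃ r : M, r = 637 := ⟨_, rfl⟩
  have key : v ^ 3 + p / 2 * v ^ 2 + (p ^ 2 - 4 * r) / 16 * v - q ^ 2 / 64 =
      v ^ 3 + 117 * v ^ 2 + 3263 * v - 8281 := by
    rw [hp, hq, hr]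
    ring
  rw [← hp] at h2
  rw [← hq] at h3
  rw [← hr] at h4
  rw [← key, (neg_eq_iff_eq_neg.2 h3).symm, ← h2, ← h4]
  ring

end Quartic

section Descent

variable {M : Type*} [Field M] [CharZero M]

theorem octicFactor_root {x s : M} (hM : (quartic M).Splits) (hs : s ^ 2 = 13)
    (hx : octicFactor x s = 0) : ∃ a, (quartic M).IsRoot a ∧ octicRoot a s = x := by
  classical
  have hspec {a : M} (ha : (quartic M).IsRoot a) := octicRoot_spec (a := a) (s := s)
    (by rw [← eval_quartic]; exact ha) hs
  set q : M[X] := X ^ 4 + C (55 / 6 - 5 / 6 * s) * X ^ 3 + C (79 / 2 - 35 / 6 * s) * X ^ 2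
    + C (155 / 2 - 971 / 54 * s) * X + C (11251 / 162 - 2875 / 162 * s) with hq
  have heval (y : M) : q.eval y = octicFactor y s := by
    simp only [hq, octicFactor, eval_add, eval_mul, eval_pow, eval_C, eval_X]
    ring
  have hq_deg : q.natDegree = 4 := by
    rw [hq]
    compute_degree!
  have hq0 : q ≠ 0 := ne_zero_of_natDegree_gt (n := 0) (by omega)
  have hp0 : quartic M ≠ 0 := (quartic_monic M).ne_zero
  have hcard : (quartic M).roots.toFinset.card = 4 := by
    rw [Multiset.toFinset_card_of_nodup (nodup_roots (quartic_separable M)),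
      ← hM.natDegree_eq_card_roots, quartic_natDegree]
  have himage : (quartic M).roots.toFinset.image (octicRoot · s) = q.roots.toFinset := by
    refine Finset.eq_of_subset_of_card_le ?_ ?_
    · intro y hy
      simp only [Finset.mem_image, Multiset.mem_toFinset, mem_roots hp0] at hy
      obtain ⟨a, ha, rfl⟩ := hy
      rw [Multiset.mem_toFinset, mem_roots hq0, IsRoot, heval]
      exact (hspec ha).1
    · rw [Finset.card_image_of_injOn, hcard, ← hq_deg]
      · exact (Multiset.toFinset_card_le _).trans (card_roots' q)
      · intro a ha b hb hab
        simp only [Finset.mem_coe, Multiset.mem_toFinset, mem_roots hp0] at ha hb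
        rw [← (hspec ha).2, ← (hspec hb).2]
        exact congrArg (octicInv · s) hab
  have hmem : x ∈ q.roots.toFinset := by
    rw [Multiset.mem_toFinset, mem_roots hq0, IsRoot, heval, hx]
  rw [← himage] at hmem
  simpa [hp0] using hmem

theorem octicRoot_mem {S : Subfield M} {a s : M} (ha : a ∈ S) (hs : s ∈ S) :
    octicRoot a s ∈ S := by
  have h : S.subtype (octicRoot ⟨a, ha⟩ ⟨s, hs⟩) = octicRoot a s := by
    simp only [octicRoot, map_add, map_sub, map_mul, map_div₀, map_neg, map_pow, map_ofNat,
      Subfield.subtype_apply]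
  exact h ▸ SetLike.coe_mem _

theorem octicInv_mem {S : Subfield M} {x s : M} (hx : x ∈ S) (hs : s ∈ S) :
    octicInv x s ∈ S := by
  have h : S.subtype (octicInv ⟨x, hx⟩ ⟨s, hs⟩) = octicInv x s := by
    simp only [octicInv, map_add, map_sub, map_mul, map_div₀, map_neg, map_pow, map_ofNat,
      Subfield.subtype_apply]
  exact h ▸ SetLike.coe_mem _

theorem sexticFactor_root_mem {S : Subfield M} {a : Fin 4 → M} {x s : M}
    (hinj : Function.Injective a) (ha : ∀ i, (quartic M).IsRoot (a i)) (haS : ∀ i, a i ∈ S)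
    (hsS : s ∈ S) (hs : s ^ 2 = 13) (hx : sexticFactor x = 0) : x ∈ S := by
  obtain ⟨hr, hsq⟩ := sexticToResolvent_spec hx
  obtain ⟨b, hb⟩ : ∃ b : S, sexticToResolvent x = b ^ 2 := by
    rw [resolventCubic_factor hinj ha] at hr
    have hmem (i : Fin 4) : (a 0 + a i) / 2 ∈ S :=
      S.div_mem (S.add_mem (haS 0) (haS i)) (ofNat_mem S 2)
    rcases mul_eq_zero.1 hr with hr | hr
    · rcases mul_eq_zero.1 hr with hr | hr
      · exact ⟨⟨_, hmem 1⟩, sub_eq_zero.1 hr⟩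
      · exact ⟨⟨_, hmem 2⟩, sub_eq_zero.1 hr⟩
    · exact ⟨⟨_, hmem 3⟩, sub_eq_zero.1 hr⟩
  rw [hb] at hsq
  lift s to S using hsS
  obtain ⟨c, hc⟩ : ∃ c : S, (c : M) = 1 / 10 - b ^ 2 / 105 - (b ^ 2) ^ 2 / 1365 := by
    refine ⟨1 / 10 - b ^ 2 / 105 - (b ^ 2) ^ 2 / 1365, ?_⟩
    simp only [← Subfield.subtype_apply, map_sub, map_div₀, map_pow, map_one, map_ofNat]
  obtain ⟨d, hd⟩ : ∃ d : S,
      (d : M) = s * (17 / 1820 + 2 * b ^ 2 / 1365 + (b ^ 2) ^ 2 / 23660) * b := by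
    refine ⟨s * (17 / 1820 + 2 * b ^ 2 / 1365 + (b ^ 2) ^ 2 / 23660) * b, ?_⟩
    simp only [← Subfield.subtype_apply, map_add, map_mul, map_div₀, map_pow, map_ofNat]
  rw [← hc, ← hs, ← mul_pow, ← mul_pow, ← hd, sq_eq_sq_iff_eq_or_eq_neg] at hsq
  rcases hsq with h | h
  · rw [sub_eq_iff_eq_add.1 h]
    exact S.add_mem d.2 c.2
  · rw [sub_eq_iff_eq_add.1 h]
    exact S.add_mem (S.neg_mem d.2) c.2

end Descent

section AlternatingGroup

theorem surjective_of_six_dvd_card {G : Type*} [Group G] (φ : G →* alternatingGroup (Fin 4))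
    (hφ : Function.Injective φ) (h : 6 ∣ Nat.card G) : Function.Surjective φ := by
  have hA : Nat.card (alternatingGroup (Fin 4)) = 12 := by
    rw [nat_card_alternatingGroup, Nat.card_fin]
    rfl
  rw [← MonoidHom.range_eq_top, ← Subgroup.index_eq_one]
  have hmul := φ.range.card_mul_index
  rw [hA, Nat.card_congr (MonoidHom.ofInjective hφ).symm.toEquiv] at hmul
  obtain ⟨k, hk⟩ := h
  have hindex : φ.range.index ∣ 2 := ⟨k, by rw [hk] at hmul; linarith⟩
  refine ((Nat.dvd_prime Nat.prime_two).1 hindex).resolve_right fun h2 => ?_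
  have hle : Subgroup.closure {σ : Equiv.Perm (Fin 4) | σ.IsThreeCycle} ≤
      φ.range.map (alternatingGroup (Fin 4)).subtype := by
    rw [Subgroup.closure_le]
    intro c hc
    have hcA : c ∈ alternatingGroup (Fin 4) := hc.mem_alternatingGroup
    refine ⟨(⟨c, hcA⟩ ^ 2) ^ 2, Subgroup.sq_mem_of_index_two h2 _, ?_⟩
    have : c ^ 3 = 1 := by rw [← hc.orderOf, pow_orderOf_eq_one]
    simp [← pow_mul, pow_succ c 3, this]
  rw [Equiv.Perm.closure_three_cycles_eq_alternating] at hle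
  have htop : φ.range = ⊤ := by
    rw [eq_top_iff]
    intro g _
    obtain ⟨g', hg', h⟩ := hle g.2
    rwa [← Subtype.ext h]
  rw [htop, Subgroup.index_top] at h2
  omega

variable {K : Type*} [Field K] [Algebra ℚ K]

theorem quartic_card_rootSet {L : Type*} [Field L] [Algebra K L]
    (hL : ((quartic K).map (algebraMap K L)).Splits) :
    Fintype.card ((quartic K).rootSet L) = 4 := by
  rw [card_rootSet_eq_natDegree (quartic_separable K) hL, quartic_natDegree]

theorem natDegree_dvd_finrank {L : Type*} [Field L] [Algebra ℚ L] [FiniteDimensional ℚ L]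
    {p : ℚ[X]} (hp : Irreducible p) {x : L} (hx : aeval x p = 0) :
    p.natDegree ∣ Module.finrank ℚ L := by
  have h := minpoly.degree_dvd (K := ℚ) (x := x) (Algebra.IsIntegral.isIntegral x)
  rwa [← minpoly.eq_of_irreducible hp hx, natDegree_mul_C (by simp [hp.ne_zero])] at h

theorem quartic_discr {L : Type*} [Field L] [CharZero L] {a : Fin 4 → L}
    (hinj : Function.Injective a) (ha : ∀ i, (quartic L).IsRoot (a i)) :
    (Matrix.vandermonde a).det ^ 2 = 13 * 582400 ^ 2 := by
  obtain ⟨h1, h2, h3, h4⟩ := quartic_vieta hinj ha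
  obtain ⟨p, hp⟩ : ∃ p : L, p = 234 := ⟨_, rfl⟩
  obtain ⟨q, hq⟩ : ∃ q : L, q = 728 := ⟨_, rfl⟩
  obtain ⟨r, hr⟩ : ∃ r : L, r = 637 := ⟨_, rfl⟩
  have key : 16 * p ^ 4 * r - 4 * p ^ 3 * q ^ 2 - 128 * p ^ 2 * r ^ 2 + 144 * p * q ^ 2 * r
      - 27 * q ^ 4 + 256 * r ^ 3 = 13 * 582400 ^ 2 := by
    rw [hp, hq, hr]
    norm_num
  have h0 : a 3 = -(a 0 + a 1 + a 2) := by linear_combination h1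
  rw [← hp] at h2
  rw [← hq] at h3
  rw [← hr] at h4
  rw [← key, (neg_eq_iff_eq_neg.2 h3).symm, ← h2, ← h4, Matrix.det_vandermonde]
  simp only [Fin.prod_univ_four, show Finset.Ioi (0 : Fin 4) = {1, 2, 3} from rfl,
    show Finset.Ioi (1 : Fin 4) = {2, 3} from rfl, show Finset.Ioi (2 : Fin 4) = {3} from rfl,
    show Finset.Ioi (3 : Fin 4) = ∅ from rfl]
  simp
  rw [h0]
  ring

theorem quartic_gal_equiv_alternatingGroup (hK : Module.finrank ℚ K = 2) {s : K}
    (hs : s ^ 2 = 13) : Nonempty ((quartic K).Gal ≃* alternatingGroup (Fin 4)) := by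
  have : CharZero K := algebraRat.charZero K
  let L := (quartic K).SplittingField
  have : CharZero L := algebraRat.charZero L
  have hsplit := SplittingField.splits (quartic K)
  have : Fact ((quartic K).map (algebraMap K L)).Splits := ⟨hsplit⟩
  let e : Fin 4 ≃ (quartic K).rootSet L :=
    (Fintype.equivFinOfCardEq (quartic_card_rootSet hsplit)).symm
  let a : Fin 4 → L := fun i => e i
  have hinj : Function.Injective a := Subtype.val_injective.comp e.injective
  have ha (i : Fin 4) : (quartic L).IsRoot (a i) := by
    rw [← quartic_map (algebraMap K L), IsRoot, eval_map_algebraMap]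
    exact aeval_eq_zero_of_mem_rootSet (e i).2
  let π : (quartic K).Gal →* Equiv.Perm (Fin 4) :=
    (e.symm.permCongrHom : _ →* _).comp (Gal.galActionHom (quartic K) L)
  have hπ : Function.Injective π :=
    e.symm.permCongrHom.injective.comp (Gal.galActionHom_injective (quartic K) L)
  have hsign (σ : (quartic K).Gal) : π σ ∈ alternatingGroup (Fin 4) := by
    obtain ⟨τ, rfl⟩ := Gal.restrict_surjective (quartic K) L σ
    set ρ := π (Gal.restrict (quartic K) L τ) with hρ
    have hτ (i : Fin 4) : τ (a i) = a (ρ i) := by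
      rw [← Gal.galActionHom_restrict]
      simp [a, hρ, π]
    set D := (Matrix.vandermonde a).det with hD
    have hD0 : D ≠ 0 := Matrix.det_vandermonde_ne_zero_iff.2 hinj
    have hfix : τ D = D := by
      have hsq : D ^ 2 = (algebraMap K L (s * 582400)) ^ 2 := by
        rw [hD, quartic_discr hinj ha, ← map_pow, mul_pow, hs]
        simp only [map_mul, map_pow, map_ofNat (algebraMap K L)]
      rcases sq_eq_sq_iff_eq_or_eq_neg.1 hsq with h | h <;> simp [h]
    have hmap : τ D = (Equiv.Perm.sign ρ : ℤ) * D := by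
      rw [hD, ← Matrix.det_permute, AlgEquiv.map_det]
      congr 1
      ext i j
      simp [Matrix.vandermonde_apply, hτ]
    rw [Equiv.Perm.mem_alternatingGroup]
    refine (Int.units_eq_one_or _).resolve_right fun h => hD0 ?_
    rw [hfix, h] at hmap
    push_cast at hmap
    linear_combination (1 / 2) * hmap
  have hcard : 6 ∣ Nat.card (quartic K).Gal := by
    have : FiniteDimensional ℚ K := FiniteDimensional.of_finrank_pos (by omega)
    have : FiniteDimensional ℚ L := FiniteDimensional.trans ℚ K L
    have h4 := natDegree_dvd_finrank quartic_irreducible (x := a 0) (by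
      rw [← eval_map_algebraMap, quartic_map]
      exact ha 0)
    have h3 := natDegree_dvd_finrank resolventCubic_irreducible (x := ((a 0 + a 1) / 2) ^ 2) (by
      simp only [resolventCubic, map_sub, map_add, map_mul, map_pow, aeval_X, map_ofNat]
      rw [resolventCubic_factor hinj ha]
      ring)
    rw [quartic_natDegree] at h4
    rw [resolventCubic_natDegree] at h3
    rw [← Module.finrank_mul_finrank ℚ K L, hK] at h3 h4
    rw [Gal.card_of_separable (quartic_separable K)]
    change 6 ∣ Module.finrank K L
    omega
  let φ : (quartic K).Gal →* alternatingGroup (Fin 4) := π.codRestrict _ hsign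
  have hφ : Function.Injective φ := fun σ τ h => hπ (congrArg Subtype.val h)
  exact ⟨MulEquiv.ofBijective φ ⟨hφ, surjective_of_six_dvd_card φ hφ hcard⟩⟩

end AlternatingGroup

section Splitting

theorem gal_equiv_of_adjoin_rootSet_eq {K Ω : Type*} [Field K] [Field Ω] [Algebra K Ω]
    [IsAlgClosed Ω] {p q : K[X]} (h : adjoin K (p.rootSet Ω) = adjoin K (q.rootSet Ω)) :
    Nonempty (p.Gal ≃* q.Gal) := by
  have hp := adjoin_rootSet_isSplittingField (IsAlgClosed.splits (p.map (algebraMap K Ω)))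
  have hq := adjoin_rootSet_isSplittingField (IsAlgClosed.splits (q.map (algebraMap K Ω)))
  rw [h] at hp
  exact ⟨(IsSplittingField.algEquiv (adjoin K (q.rootSet Ω)) p).symm.autCongr.trans
    (IsSplittingField.algEquiv (adjoin K (q.rootSet Ω)) q).autCongr⟩

theorem aeval_F15 {Ω : Type*} [Field Ω] [Algebra K13 Ω] (x : Ω) :
    aeval x F15 = (x ^ 2 + 5 * x + 13) * (x ^ 4 + 7 * x ^ 3 + 20 * x ^ 2 + 19 * x + 1) ^ 3
      - 11225615440 / 1594323 * x := by
  simp only [F15, P13, map_sub, map_add, map_mul, map_pow, aeval_X, aeval_C, map_ofNat, map_one,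
    map_div₀]

theorem exists_sq_eq_thirteen : ∃ s : K13, s ^ 2 = 13 := by
  refine ⟨⟨√13, mem_adjoin_simple_self ℚ _⟩, Subtype.ext ?_⟩
  exact Real.sq_sqrt (by norm_num : (0 : ℝ) ≤ 13)

theorem finrank_K13 : Module.finrank ℚ K13 = 2 := by
  have hmonic : (X ^ 2 - C 13 : ℚ[X]).Monic := monic_X_pow_sub_C 13 two_ne_zero
  have hirr : Irreducible (X ^ 2 - C 13 : ℚ[X]) := by
    refine X_pow_sub_C_irreducible_of_prime Nat.prime_two fun b hb => ?_
    have h : Irrational √13 := (Nat.Prime.irrational_sqrt (p := 13) (by norm_num))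
    apply h
    refine ⟨|b|, ?_⟩
    rw [eq_comm, Real.sqrt_eq_iff_mul_self_eq (by norm_num) (by positivity)]
    push_cast
    rw [abs_mul_abs_self, ← sq]
    exact_mod_cast hb.symm
  have hroot : aeval √13 (X ^ 2 - C 13 : ℚ[X]) = 0 := by simp
  have hmin := minpoly.eq_of_irreducible_of_monic hirr hroot hmonic
  rw [K13, adjoin.finrank ⟨_, hmonic, hroot⟩, ← hmin, natDegree_X_pow_sub_C]

theorem adjoin_rootSet_F15 (Ω : Type*) [Field Ω] [CharZero Ω] [Algebra K13 Ω] [IsAlgClosed Ω] :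
    adjoin K13 (F15.rootSet Ω) = adjoin K13 ((quartic K13).rootSet Ω) := by
  obtain ⟨s, hs⟩ := exists_sq_eq_thirteen
  replace hs : (algebraMap K13 Ω s) ^ 2 = 13 := by rw [← map_pow, hs, map_ofNat]
  have hF0 : F15 ≠ 0 := by
    intro h
    have h0 := aeval_F15 (0 : Ω)
    rw [h, map_zero] at h0
    norm_num at h0
  have hF (x : Ω) : x ∈ F15.rootSet Ω ↔ sexticFactor x * octicFactor x (algebraMap K13 Ω s) *
      octicFactor x (-algebraMap K13 Ω s) = 0 := by
    rw [mem_rootSet, aeval_F15, octic_sextic_factorization hs, and_iff_right hF0]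
  have hquartic (x : Ω) : x ∈ (quartic K13).rootSet Ω ↔ (quartic Ω).IsRoot x := by
    rw [mem_rootSet, and_iff_right (quartic_monic K13).ne_zero, ← eval_map_algebraMap,
      quartic_map, IsRoot]
  have hmem (E : IntermediateField K13 Ω) : algebraMap K13 Ω s ∈ E.toSubfield :=
    E.algebraMap_mem s
  refine le_antisymm (adjoin_le_iff.2 fun x hx => ?_) (adjoin_le_iff.2 fun a ha => ?_)
  · let L := adjoin K13 ((quartic K13).rootSet Ω)
    have hsub {a : Ω} (ha : (quartic Ω).IsRoot a) :
        a ∈ L.toSubfield :=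
      subset_adjoin _ _ ((hquartic a).2 ha)
    have hsplit : (quartic Ω).Splits := IsAlgClosed.splits _
    rcases mul_eq_zero.1 ((hF x).1 hx) with h | h
    · rcases mul_eq_zero.1 h with h | h
      · have hsplit' := IsAlgClosed.splits ((quartic K13).map (algebraMap K13 Ω))
        let e := (Fintype.equivFinOfCardEq (quartic_card_rootSet hsplit')).symm
        have hroot (i : Fin 4) : (quartic Ω).IsRoot (e i) := (hquartic _).1 (e i).2
        exact sexticFactor_root_mem (S := L.toSubfield)
          (Subtype.val_injective.comp e.injective) hroot (fun i => hsub (hroot i)) (hmem L) hs h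
      · obtain ⟨a, ha, rfl⟩ := octicFactor_root hsplit hs h
        exact octicRoot_mem (S := L.toSubfield) (hsub ha) (hmem L)
    · obtain ⟨a, ha, rfl⟩ := octicFactor_root hsplit ((neg_sq _).trans hs) h
      exact octicRoot_mem (S := L.toSubfield) (hsub ha) (neg_mem (hmem L))
  · have hroot := (hquartic a).1 ha
    rw [IsRoot, eval_quartic] at hroot
    obtain ⟨h, hinv⟩ := octicRoot_spec hroot hs
    rw [← hinv]
    exact octicInv_mem (S := (adjoin K13 (F15.rootSet Ω)).toSubfield)
      (subset_adjoin _ _ ((hF _).2 (by simp [h]))) (hmem (adjoin K13 (F15.rootSet Ω)))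

end Splitting

/-- The Galois group over `K = ℚ(√13)` of `F(X) = P(X) − (11225615440/1594323)·X` is
isomorphic to the alternating group `A₄`. -/
theorem gal_F15_iso_A4 : Nonempty (F15.Gal ≃* alternatingGroup (Fin 4)) := by
  obtain ⟨s, hs⟩ := exists_sq_eq_thirteen
  obtain ⟨φ⟩ := gal_equiv_of_adjoin_rootSet_eq (adjoin_rootSet_F15 (AlgebraicClosure K13))
  obtain ⟨ψ⟩ := quartic_gal_equiv_alternatingGroup finrank_K13 hs
  exact ⟨φ.trans ψ⟩
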